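/- Let u : ℝ³ → ℝ³ be smooth with compact support and divergence free, and let S = (1/2)(Du + Duᵀ) be the strain matrix and ω = curl u the vorticity. Then ∫_{ℝ³} ⟨ω(x), S(x) ω(x)⟩ dx = −4 ∫_{ℝ³} det(S(x)) dx. -/

import Mathlib

open Matrix MeasureTheory

/-- Partial derivative `∂ᵢ f` of a scalar field on `ℝ³`. -/
noncomputable def pd (i : Fin 3) (f : (Fin 3 → ℝ) → ℝ) (x : Fin 3 → ℝ) : ℝ :=
  fderiv ℝ f x (Pi.single i 1)

/-- The Jacobian matrix of `u : ℝ³ → ℝ³`, with entries `(Du)ᵢⱼ = ∂ᵢuⱼ`. -/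
noncomputable def jacobian (u : (Fin 3 → ℝ) → (Fin 3 → ℝ)) (x : Fin 3 → ℝ) :
    Matrix (Fin 3) (Fin 3) ℝ :=
  Matrix.of fun i j => pd i (fun y => u y j) x

/-- The strain matrix `∇_sym u = (1/2)(Du + Duᵀ)`. -/
noncomputable def strain (u : (Fin 3 → ℝ) → (Fin 3 → ℝ)) (x : Fin 3 → ℝ) :
    Matrix (Fin 3) (Fin 3) ℝ :=
  (1 / 2 : ℝ) • (jacobian u x + (jacobian u x)ᵀ)

/-- The divergence `div u = Σᵢ ∂ᵢuᵢ`. -/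
noncomputable def div3 (u : (Fin 3 → ℝ) → (Fin 3 → ℝ)) (x : Fin 3 → ℝ) : ℝ :=
  ∑ i, pd i (fun y => u y i) x

/-- The curl `curl u = (∂₂u₃−∂₃u₂, ∂₃u₁−∂₁u₃, ∂₁u₂−∂₂u₁)`. -/
noncomputable def curl3 (u : (Fin 3 → ℝ) → (Fin 3 → ℝ)) (x : Fin 3 → ℝ) : Fin 3 → ℝ :=
  ![pd 1 (fun y => u y 2) x - pd 2 (fun y => u y 1) x,
    pd 2 (fun y => u y 0) x - pd 0 (fun y => u y 2) x,
    pd 0 (fun y => u y 1) x - pd 1 (fun y => u y 0) x]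

theorem contDiff_pd {f : (Fin 3 → ℝ) → ℝ} (hf : ContDiff ℝ (⊤ : ℕ∞) f) (i : Fin 3) :
    ContDiff ℝ (⊤ : ℕ∞) (pd i f) :=
  (hf.fderiv_right (m := (⊤ : ℕ∞)) (by norm_cast)).clm_apply contDiff_const

theorem pd_comm {f : (Fin 3 → ℝ) → ℝ} (hf : ContDiff ℝ (⊤ : ℕ∞) f) (i j : Fin 3)
    (x : Fin 3 → ℝ) : pd i (pd j f) x = pd j (pd i f) x := by
  have hd : DifferentiableAt ℝ (fderiv ℝ f) x :=
    ((hf.fderiv_right (m := (⊤ : ℕ∞)) (by norm_cast)).differentiable (by simp)) x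
  have key (a b : Fin 3) : pd a (pd b f) x
      = fderiv ℝ (fderiv ℝ f) x (Pi.single a 1) (Pi.single b 1) := by
    unfold pd
    rw [fderiv_clm_apply hd (differentiableAt_const _)]
    simp
  rw [key, key]
  exact (hf.contDiffAt.isSymmSndFDerivAt
    (by simp only [minSmoothness_of_isRCLikeNormedField]; exact WithTop.coe_le_coe.2 (le_top : (2 : ℕ∞) ≤ ⊤))) _ _

theorem pd_mul {f g : (Fin 3 → ℝ) → ℝ} (hf : ContDiff ℝ (⊤ : ℕ∞) f)
    (hg : ContDiff ℝ (⊤ : ℕ∞) g) (i : Fin 3) (x : Fin 3 → ℝ) :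
    pd i (fun y => f y * g y) x = f x * pd i g x + pd i f x * g x := by
  unfold pd
  rw [fderiv_fun_mul (hf.differentiable (by simp) x) (hg.differentiable (by simp) x)]
  simp [mul_comm]

theorem pd_sub {f g : (Fin 3 → ℝ) → ℝ} (hf : ContDiff ℝ (⊤ : ℕ∞) f)
    (hg : ContDiff ℝ (⊤ : ℕ∞) g) (i : Fin 3) (x : Fin 3 → ℝ) :
    pd i (fun y => f y - g y) x = pd i f x - pd i g x := by
  unfold pd
  rw [fderiv_fun_sub (hf.differentiable (by simp) x) (hg.differentiable (by simp) x)]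
  simp

theorem integrable_pd {f : (Fin 3 → ℝ) → ℝ} (hf : ContDiff ℝ (⊤ : ℕ∞) f)
    (hs : HasCompactSupport f) (i : Fin 3) : Integrable (pd i f) :=
  (contDiff_pd hf i).continuous.integrable_of_hasCompactSupport (hs.fderiv_apply ℝ _)

theorem integral_pd_eq_zero {f : (Fin 3 → ℝ) → ℝ} (hf : ContDiff ℝ (⊤ : ℕ∞) f)
    (hs : HasCompactSupport f) (i : Fin 3) : ∫ x, pd i f x = 0 := by
  have h := integral_mul_fderiv_eq_neg_fderiv_mul_of_integrable (μ := volume)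
    (f := fun _ : Fin 3 → ℝ => (1 : ℝ)) (g := f) (v := Pi.single i 1)
    (by simp) (by simp only [one_mul]; exact integrable_pd hf hs i)
    (by simpa using hf.continuous.integrable_of_hasCompactSupport hs)
    (fun _ _ => differentiableAt_const _) (fun x _ => hf.differentiable (by simp) x)
  simpa [pd] using h

/-- The Jacobian determinant is the divergence of `u₀` times the first column of cofactors. -/
theorem det_jacobian_eq_divergence {u : (Fin 3 → ℝ) → (Fin 3 → ℝ)}
    (hu : ContDiff ℝ (⊤ : ℕ∞) u) (x : Fin 3 → ℝ) :
    (jacobian u x).det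
      = pd 0 (fun y => u y 0 * (pd 1 (fun z => u z 1) y * pd 2 (fun z => u z 2) y
          - pd 2 (fun z => u z 1) y * pd 1 (fun z => u z 2) y)) x
        + pd 1 (fun y => u y 0 * (pd 2 (fun z => u z 1) y * pd 0 (fun z => u z 2) y
          - pd 0 (fun z => u z 1) y * pd 2 (fun z => u z 2) y)) x
        + pd 2 (fun y => u y 0 * (pd 0 (fun z => u z 1) y * pd 1 (fun z => u z 2) y
          - pd 1 (fun z => u z 1) y * pd 0 (fun z => u z 2) y)) x := by
  have hc (j : Fin 3) : ContDiff ℝ (⊤ : ℕ∞) (fun y => u y j) := contDiff_pi.1 hu j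
  have hp (i j : Fin 3) : ContDiff ℝ (⊤ : ℕ∞) (pd i (fun y => u y j)) := contDiff_pd (hc j) i
  have expand (a b c : Fin 3) :
      pd c (fun y => u y 0 * (pd a (fun z => u z 1) y * pd b (fun z => u z 2) y
        - pd b (fun z => u z 1) y * pd a (fun z => u z 2) y)) x
      = u x 0 * (pd a (fun z => u z 1) x * pd c (pd b (fun z => u z 2)) x
          + pd c (pd a (fun z => u z 1)) x * pd b (fun z => u z 2) x
          - (pd b (fun z => u z 1) x * pd c (pd a (fun z => u z 2)) x
          + pd c (pd b (fun z => u z 1)) x * pd a (fun z => u z 2) x))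
        + pd c (fun z => u z 0) x * (pd a (fun z => u z 1) x * pd b (fun z => u z 2) x
          - pd b (fun z => u z 1) x * pd a (fun z => u z 2) x) := by
    rw [pd_mul (hc 0) (((hp a 1).mul (hp b 2)).sub ((hp b 1).mul (hp a 2))),
      pd_sub ((hp a 1).mul (hp b 2)) ((hp b 1).mul (hp a 2)),
      pd_mul (hp a 1) (hp b 2), pd_mul (hp b 1) (hp a 2)]
  rw [expand, expand, expand, pd_comm (hc 1) 1 0, pd_comm (hc 1) 2 0, pd_comm (hc 1) 2 1,
    pd_comm (hc 2) 1 0, pd_comm (hc 2) 2 0, pd_comm (hc 2) 2 1, det_fin_three]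
  simp only [jacobian, of_apply]
  ring

theorem integral_det_jacobian_eq_zero {u : (Fin 3 → ℝ) → (Fin 3 → ℝ)}
    (hu : ContDiff ℝ (⊤ : ℕ∞) u) (hs : HasCompactSupport u) :
    ∫ x, (jacobian u x).det = 0 := by
  have hc (j : Fin 3) : ContDiff ℝ (⊤ : ℕ∞) (fun y => u y j) := contDiff_pi.1 hu j
  have hp (i j : Fin 3) : ContDiff ℝ (⊤ : ℕ∞) (pd i (fun y => u y j)) := contDiff_pd (hc j) i
  have hs0 : HasCompactSupport (fun y => u y 0) := hs.comp_left (g := fun v : Fin 3 → ℝ => v 0) rfl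
  have smooth (a b : Fin 3) := (hc 0).mul (((hp a 1).mul (hp b 2)).sub ((hp b 1).mul (hp a 2)))
  have supp (g : (Fin 3 → ℝ) → ℝ) : HasCompactSupport (fun y => u y 0 * g y) := hs0.mul_right
  simp_rw [det_jacobian_eq_divergence hu]
  rw [integral_add, integral_add, integral_pd_eq_zero (smooth 1 2) (supp _),
    integral_pd_eq_zero (smooth 2 0) (supp _), integral_pd_eq_zero (smooth 0 1) (supp _)]
  · simp
  · exact integrable_pd (smooth 1 2) (supp _) 0
  · exact integrable_pd (smooth 2 0) (supp _) 1
  · exact (integrable_pd (smooth 1 2) (supp _) 0).add (integrable_pd (smooth 2 0) (supp _) 1)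
  · exact integrable_pd (smooth 0 1) (supp _) 2

theorem jacobian_eq_of_fderiv {u : (Fin 3 → ℝ) → (Fin 3 → ℝ)} {x : Fin 3 → ℝ}
    (hu : DifferentiableAt ℝ u x) :
    jacobian u x = of fun i j => fderiv ℝ u x (Pi.single i 1) j := by
  ext i j
  simp [jacobian, pd, fderiv_apply hu]

theorem integrable_comp_jacobian {u : (Fin 3 → ℝ) → (Fin 3 → ℝ)}
    (hu : ContDiff ℝ (⊤ : ℕ∞) u) (hs : HasCompactSupport u)
    {F : Matrix (Fin 3) (Fin 3) ℝ → ℝ} (hF : Continuous F) (hF0 : F 0 = 0) :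
    Integrable fun x => F (jacobian u x) := by
  have hJ : jacobian u = fun x => of fun i j => fderiv ℝ u x (Pi.single i 1) j :=
    funext fun x => jacobian_eq_of_fderiv (hu.differentiable (by simp) x)
  have hcont : Continuous (jacobian u) :=
    continuous_matrix fun i j => (contDiff_pd (contDiff_pi.1 hu j) i).continuous
  have hsJ : HasCompactSupport (jacobian u) := by
    rw [hJ]
    exact (hs.fderiv ℝ).comp_left
      (g := fun L : (Fin 3 → ℝ) →L[ℝ] (Fin 3 → ℝ) => of fun i j => L (Pi.single i 1) j) rfl
  exact (hF.comp hcont).integrable_of_hasCompactSupport (hsJ.comp_left hF0)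

/-- With `w` the axial vector of the antisymmetric part `W` of `A = S + W`, one has
`det A = det S + ⟨w, S w⟩`. -/
theorem vortex_stretching_eq_det_sub_det (u : (Fin 3 → ℝ) → (Fin 3 → ℝ)) (x : Fin 3 → ℝ) :
    ∑ i, ∑ j, strain u x i j * curl3 u x i * curl3 u x j
      = 4 * (jacobian u x).det - 4 * (strain u x).det := by
  simp only [det_fin_three, Fin.sum_univ_three, strain, curl3, jacobian, Matrix.smul_apply, Matrix.add_apply,
    transpose_apply, of_apply, smul_eq_mul, cons_val]
  ring

theorem integral_vortex_stretching_eq_neg_four_integral_det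
    (u : (Fin 3 → ℝ) → (Fin 3 → ℝ))
    (hsmooth : ContDiff ℝ (⊤ : ℕ∞) u) (hsupp : HasCompactSupport u)
    (hdiv : ∀ x, div3 u x = 0) :
    ∫ x : Fin 3 → ℝ, (∑ i, ∑ j, strain u x i j * curl3 u x i * curl3 u x j)
      = -4 * ∫ x : Fin 3 → ℝ, (strain u x).det := by
  have hJ : Integrable fun x => (jacobian u x).det :=
    integrable_comp_jacobian hsmooth hsupp (F := det) (by fun_prop) (by simp)
  have hS : Integrable fun x => (strain u x).det :=
    integrable_comp_jacobian hsmooth hsupp (F := fun A => ((1 / 2 : ℝ) • (A + Aᵀ)).det)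
      (by fun_prop) (by simp)
  simp_rw [vortex_stretching_eq_det_sub_det]
  rw [integral_sub (hJ.const_mul 4) (hS.const_mul 4), integral_const_mul, integral_const_mul,
    integral_det_jacobian_eq_zero hsmooth hsupp]
  ring
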